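/- For all integers n ≥ 2 and all real y with 0 ≤ y ≤ 2, one has h_n(y) ≤ exp(10 − 10/n), where h_n(y) = n^{−y}·J_n(y). -/

import Mathlib

open Filter Finset

def GJRec (y : ℝ) (t : ℕ → ℝ) : Prop :=
  t 0 = 2*y^2 ∧ t 1 = (20*y^3+5*y)/6 ∧ ∀ n : ℕ, t (n+2) = 4*(3*n+8)/(n+3)*
    ((n+2)*(3*n+4)/36*t n + y/6*t (n+1) + 1/36*∑ k ∈ range (n+1), t k * t (n-k))

theorem gj_nonneg_le {y : ℝ} {t s : ℕ → ℝ} (ht : GJRec y t) (hs : GJRec 2 s)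
    (h0 : 0 ≤ y) (h2 : y ≤ 2) : ∀ n, 0 ≤ t n ∧ t n ≤ s n := by
  intro n
  induction n using Nat.strong_induction_on with
  | _ n ih =>
    match n, ih with
    | 0, _ =>
      rw [ht.1, hs.1]
      exact ⟨by positivity, by gcongr⟩
    | 1, _ =>
      rw [ht.2.1, hs.2.1]
      exact ⟨by positivity, by gcongr⟩
    | n+2, ih =>
      rw [ht.2.2, hs.2.2]
      have a := ih n (by omega)
      have b := ih (n+1) (by omega)
      have c : ∀ k ∈ range (n+1), 0 ≤ t k * t (n-k) ∧ t k * t (n-k) ≤ s k * s (n-k) := by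
        intro k hk
        have hk' := mem_range.1 hk
        have a := ih k (by omega)
        have b := ih (n-k) (by omega)
        exact ⟨mul_nonneg a.1 b.1, mul_le_mul a.2 b.2 b.1 (a.1.trans a.2)⟩
      have c1 := sum_nonneg (fun k hk => (c k hk).1)
      have c2 := sum_le_sum (fun k hk => (c k hk).2)
      have a1 := a.1
      have b1 := b.1
      have a2 := a.2
      have b2 := b.2
      constructor
      · positivity
      · gcongr

theorem fact_conv (c a b : ℕ) : (a+c).factorial * (b+c).factorial ≤ c.factorial * (a+b+c).factorial := by
  induction a with
  | zero => simp
  | succ a ih =>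
    rw [show a+1+c = (a+c)+1 by ring, show a+1+b+c = (a+b+c)+1 by ring, Nat.factorial_succ,
      Nat.factorial_succ (a+b+c)]
    calc (a+c+1)*(a+c).factorial * (b+c).factorial = (a+c+1)*((a+c).factorial * (b+c).factorial) := by ring
      _ ≤ (a+b+c+1) * (c.factorial * (a+b+c).factorial) := by gcongr; omega
      _ = _ := by ring

theorem sum_split (f : ℕ → ℝ) (m : ℕ) : ∑ k ∈ range (m+6+1), f k =
    f 0 + f 1 + f 2 + ∑ k ∈ range (m+1), f (k+3) + f (m+4) + f (m+5) + f (m+6) := by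
  rw [sum_range_succ, sum_range_succ, sum_range_succ, sum_range_succ', sum_range_succ', sum_range_succ']
  ring

theorem table {s : ℕ → ℝ} (hs : GJRec 2 s) : s 0 = 8 ∧ s 1 = 85/3 ∧ s 2 = 416/3 ∧
    (∀ n, 10 ≤ n → n < 22 → s n ≤ 25 * n.factorial * (n^2-3*n)) ∧
    (∀ n, 2 ≤ n → n < 22 → s n ≤ n.factorial * (35/2*n^2)) ∧
    (∀ n, n < 22 → s n ≤ 25 * (n+2).factorial) := by
  have v0 : s 0 = 8 := by rw [hs.1]; norm_num
  have v1 : s 1 = 85/3 := by rw [hs.2.1]; norm_num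
  have v2 : s 2 = 416/3 := by
    rw [hs.2.2 0]; norm_num [sum_range_succ, v0, v1]
  have v3 : s 3 = 89507/108 := by
    rw [hs.2.2 1]; norm_num [sum_range_succ, v0, v1, v2]
  have v4 : s 4 = 155512/27 := by
    rw [hs.2.2 2]; norm_num [sum_range_succ, v0, v1, v2, v3]
  have v5 : s 5 = 88191937/1944 := by
    rw [hs.2.2 3]; norm_num [sum_range_succ, v0, v1, v2, v3, v4]
  have v6 : s 6 = 96866240/243 := by
    rw [hs.2.2 4]; norm_num [sum_range_succ, v0, v1, v2, v3, v4, v5]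
  have v7 : s 7 = 540984507811/139968 := by
    rw [hs.2.2 5]; norm_num [sum_range_succ, v0, v1, v2, v3, v4, v5, v6]
  have v8 : s 8 = 89695914568/2187 := by
    rw [hs.2.2 6]; norm_num [sum_range_succ, v0, v1, v2, v3, v4, v5, v6, v7]
  have v9 : s 9 = 1192031793692059/2519424 := by
    rw [hs.2.2 7]; norm_num [sum_range_succ, v0, v1, v2, v3, v4, v5, v6, v7, v8]
  have v10 : s 10 = 116144783771264/19683 := by
    rw [hs.2.2 8]; norm_num [sum_range_succ, v0, v1, v2, v3, v4, v5, v6, v7, v8, v9]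
  have v11 : s 11 = 2393576082627924845/30233088 := by
    rw [hs.2.2 9]; norm_num [sum_range_succ, v0, v1, v2, v3, v4, v5, v6, v7, v8, v9, v10]
  have v12 : s 12 = 201557250484917664/177147 := by
    rw [hs.2.2 10]; norm_num [sum_range_succ, v0, v1, v2, v3, v4, v5, v6, v7, v8, v9, v10, v11]
  have v13 : s 13 = 9494239466736805211891/544195584 := by
    rw [hs.2.2 11]; norm_num [sum_range_succ, v0, v1, v2, v3, v4, v5, v6, v7, v8, v9, v10, v11, v12]
  have v14 : s 14 = 453438713567403141248/1594323 := by
    rw [hs.2.2 12]; norm_num [sum_range_succ, v0, v1, v2, v3, v4, v5, v6, v7, v8, v9, v10, v11, v12, v13]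
  have v15 : s 15 = 385024173535141639492006753/78364164096 := by
    rw [hs.2.2 13]; norm_num [sum_range_succ, v0, v1, v2, v3, v4, v5, v6, v7, v8, v9, v10, v11, v12, v13, v14]
  have v16 : s 16 = 1286844754380157556439400/14348907 := by
    rw [hs.2.2 14]; norm_num [sum_range_succ, v0, v1, v2, v3, v4, v5, v6, v7, v8, v9, v10, v11, v12, v13, v14, v15]
  have v17 : s 17 = 7299476491850157107890103444023/4231664861184 := by
    rw [hs.2.2 15]; norm_num [sum_range_succ, v0, v1, v2, v3, v4, v5, v6, v7, v8, v9, v10, v11, v12, v13, v14, v15, v16]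
  have v18 : s 18 = 4503784235165884611393960992/129140163 := by
    rw [hs.2.2 16]; norm_num [sum_range_succ, v0, v1, v2, v3, v4, v5, v6, v7, v8, v9, v10, v11, v12, v13, v14, v15, v16, v17]
  have v19 : s 19 = 112653214344208468988890029338579789/152339935002624 := by
    rw [hs.2.2 17]; norm_num [sum_range_succ, v0, v1, v2, v3, v4, v5, v6, v7, v8, v9, v10, v11, v12, v13, v14, v15, v16, v17, v18]
  have v20 : s 20 = 19073030464788212018037041193976/1162261467 := by
    rw [hs.2.2 18]; norm_num [sum_range_succ, v0, v1, v2, v3, v4, v5, v6, v7, v8, v9, v10, v11, v12, v13, v14, v15, v16, v17, v18, v19]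
  have v21 : s 21 = 1043101922905490571369839335679498631095/2742118830047232 := by
    rw [hs.2.2 19]; norm_num [sum_range_succ, v0, v1, v2, v3, v4, v5, v6, v7, v8, v9, v10, v11, v12, v13, v14, v15, v16, v17, v18, v19, v20]
  refine ⟨v0, v1, by rw [v2], ?_, ?_, ?_⟩
  · intro n h1 h2
    interval_cases n <;> norm_num [v0, v1, v2, v3, v4, v5, v6, v7, v8, v9, v10, v11, v12, v13, v14, v15, v16, v17, v18, v19, v20, v21, Nat.factorial]
  · intro n h1 h2
    interval_cases n <;> norm_num [v0, v1, v2, v3, v4, v5, v6, v7, v8, v9, v10, v11, v12, v13, v14, v15, v16, v17, v18, v19, v20, v21, Nat.factorial]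
  · intro n h2
    interval_cases n <;> norm_num [v0, v1, v2, v3, v4, v5, v6, v7, v8, v9, v10, v11, v12, v13, v14, v15, v16, v17, v18, v19, v20, v21, Nat.factorial]

theorem phase_one {s : ℕ → ℝ} (hs : GJRec 2 s) : ∀ n,
    (10 ≤ n → s n ≤ 25 * n.factorial * (n^2-3*n)) ∧ s n ≤ 25 * (n+2).factorial := by
  obtain ⟨v0, v1, v2, h1, -, h3⟩ := table hs
  have hnn : ∀ n, 0 ≤ s n := fun n => (gj_nonneg_le hs hs (by norm_num) le_rfl n).1
  intro n
  induction n using Nat.strong_induction_on with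
  | _ n ih =>
    by_cases hn : n < 22
    · exact ⟨fun h => h1 n h hn, h3 n hn⟩
    obtain ⟨m, rfl⟩ : ∃ m, n = m + 6 + 2 := ⟨n - 8, by omega⟩
    have hm : 14 ≤ m := by omega
    suffices H : s (m+6+2) ≤ 25 * (m+6+2).factorial * (((m+6+2 : ℕ):ℝ)^2-3*((m+6+2 : ℕ):ℝ)) by
      refine ⟨fun _ => H, H.trans ?_⟩
      rw [Nat.factorial_succ (m+6+2+1), Nat.factorial_succ (m+6+2)]
      push_cast
      have : (0:ℝ) ≤ (m+6+2).factorial := by positivity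
      have hx : (0:ℝ) ≤ m := by positivity
      rw [mul_assoc]
      refine mul_le_mul_of_nonneg_left ?_ (by norm_num)
      rw [← mul_assoc, mul_comm]
      refine mul_le_mul_of_nonneg_right ?_ this
      nlinarith
    have bulk : ∑ k ∈ range (m+1), s (k+3) * s (m+6-(k+3)) ≤ (m+1) * (25^2 * 120 * (m+5).factorial) := by
      have : ∀ k ∈ range (m+1), s (k+3) * s (m+6-(k+3)) ≤ 25^2 * 120 * (m+5).factorial := by
        intro k hk
        have hk := mem_range.1 hk
        obtain ⟨l, rfl⟩ : ∃ l, m = k + l := ⟨m - k, by omega⟩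
        rw [show k + l + 6 - (k+3) = l + 3 by omega]
        have a := (ih (k+3) (by omega)).2
        have b := (ih (l+3) (by omega)).2
        have c : ((k+5).factorial * (l+5).factorial : ℝ) ≤ 120 * (k+l+5).factorial := by
          exact_mod_cast fact_conv 5 k l
        calc s (k+3) * s (l+3) ≤ (25 * (k+3+2).factorial) * (25 * (l+3+2).factorial) :=
              mul_le_mul a b (hnn _) (by positivity)
          _ = 25^2 * ((k+5).factorial * (l+5).factorial : ℝ) := by ring
          _ ≤ 25^2 * (120 * (k+l+5).factorial) := by gcongr
          _ = _ := by ring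
      calc _ ≤ ∑ k ∈ range (m+1), (25^2 * 120 * (m+5).factorial : ℝ) := sum_le_sum this
        _ = _ := by simp
    have a4 := (ih (m+4) (by omega)).1 (by omega)
    have a5 := (ih (m+5) (by omega)).1 (by omega)
    have a6 := (ih (m+6) (by omega)).1 (by omega)
    have a7 := (ih (m+6+1) (by omega)).1 (by omega)
    rw [hs.2.2, sum_split]
    rw [show m+6-0 = m+6 by omega, show m+6-1 = m+5 by omega, show m+6-2=m+4 by omega,
      show m+6-(m+6) = 0 by omega, show m+6-(m+5) = 1 by omega, show m+6-(m+4) = 2 by omega,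
      v0, v1, v2]
    rw [Nat.factorial_succ (m+6+1)]
    rw [Nat.factorial_succ (m+6)] at a7 ⊢
    rw [Nat.factorial_succ (m+5)] at a7 a6 ⊢
    rw [Nat.factorial_succ (m+4)] at a7 a6 a5 bulk ⊢
    push_cast at a4 a5 a6 a7 bulk ⊢
    have hF : (0:ℝ) < (m+4).factorial := by positivity
    set F : ℝ := ((m+4).factorial : ℝ)
    set B := ∑ k ∈ range (m+1), s (k+3) * s (m+6-(k+3))
    obtain ⟨x, hx⟩ : ∃ x : ℝ, x = (m:ℝ) - 14 := ⟨_, rfl⟩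
    have hx0 : 0 ≤ x := by
      have : (14:ℝ) ≤ m := by exact_mod_cast hm
      linarith
    have hmx : (m:ℝ) = x + 14 := by linarith
    rw [hmx] at a4 a5 a6 a7 bulk ⊢
    rw [div_mul_eq_mul_div, div_le_iff₀ (by positivity)]
    have e1 : 0 ≤ 4*(3*(x+14+6)+8) := by positivity
    refine (mul_le_mul_of_nonneg_left (add_le_add (add_le_add (mul_le_mul_of_nonneg_left a6 (by positivity)) (mul_le_mul_of_nonneg_left a7 (by positivity))) (mul_le_mul_of_nonneg_left (add_le_add (add_le_add (add_le_add (add_le_add (add_le_add (add_le_add (mul_le_mul_of_nonneg_left a6 (by positivity)) (mul_le_mul_of_nonneg_left a5 (by positivity))) (mul_le_mul_of_nonneg_left a4 (by positivity))) bulk) (mul_le_mul_of_nonneg_right a4 (by positivity))) (mul_le_mul_of_nonneg_right a5 (by positivity))) (mul_le_mul_of_nonneg_right a6 (by positivity))) (by positivity))) e1).trans ?_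
    rw [← sub_nonneg]
    ring_nf
    positivity

theorem step_ineq {N y : ℝ} (hN : 22 ≤ N) (h0 : 0 ≤ y) (h2 : y ≤ 2) :
    4*(3*N+2)/(N+1) * ((N*(3*N-2)+28)/36 * ((N^2-2*y*N+2*y^2)/(N^2+20))
      + y/6*(N-1)*((2*N^2-2*y*N+y^2)/(2*N^2))) ≤ N*(N-1) := by
  obtain ⟨z, rfl⟩ : ∃ z, N = z + 22 := ⟨N - 22, by ring⟩
  have hz : 0 ≤ z := by linarith
  have y2 : 0 ≤ y^2 := by positivity
  have y2' : y^2 ≤ 2*y := by nlinarith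
  have y3' : y^3 ≤ 4*y := by nlinarith
  have c0 : 0 ≤ 453945536 + -10531840*y + 478720*y^2 + -2159136*y^3 := by linarith
  have c1 : 0 ≤ 103939968 + -632192*y + 6976*y^2 + -386568*y^3 := by linarith
  have c2 : 0 ≤ 9515176 + 108480*y + -5248*y^2 + -26112*y^3 := by linarith
  have c3 : 0 ≤ 435332 + 12728*y + -340*y^2 + -789*y^3 := by linarith
  have c4 : 0 ≤ 9954 + 472*y + -6*y^2 + -9*y^3 := by linarith
  have key : 0 ≤ (453945536 + -10531840*y + 478720*y^2 + -2159136*y^3)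
    + (103939968 + -632192*y + 6976*y^2 + -386568*y^3)*z
    + (9515176 + 108480*y + -5248*y^2 + -26112*y^3)*z^2
    + (435332 + 12728*y + -340*y^2 + -789*y^3)*z^3
    + (9954 + 472*y + -6*y^2 + -9*y^3)*z^4 + (91+6*y)*z^5 := by positivity
  rw [← sub_nonneg]
  have e : (z+22)*((z+22)-1) - 4*(3*(z+22)+2)/((z+22)+1) * (((z+22)*(3*(z+22)-2)+28)/36 * (((z+22)^2-2*y*(z+22)+2*y^2)/((z+22)^2+20))
      + y/6*((z+22)-1)*((2*(z+22)^2-2*y*(z+22)+y^2)/(2*(z+22)^2))) = 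
    ((453945536 + -10531840*y + 478720*y^2 + -2159136*y^3)
    + (103939968 + -632192*y + 6976*y^2 + -386568*y^3)*z
    + (9515176 + 108480*y + -5248*y^2 + -26112*y^3)*z^2
    + (435332 + 12728*y + -340*y^2 + -789*y^3)*z^3
    + (9954 + 472*y + -6*y^2 + -9*y^3)*z^4 + (91+6*y)*z^5) / (9*((z+22)+1)*((z+22)^2+20)*(z+22)^2) := by
    have h1 : (z+22)+1 ≠ 0 := by positivity
    have h2 : (z+22) ≠ 0 := by positivity
    have h3 : (z+22)^2+20 ≠ 0 := by positivity
    field_simp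
    ring
  rw [e]
  positivity

theorem exp_neg_le_quad {x : ℝ} (hx : 0 ≤ x) : Real.exp (-x) ≤ 1 - x + x^2/2 := by
  have h := Real.quadratic_le_exp_of_nonneg hx
  rw [Real.exp_neg]
  have hp : 0 < 1 + x + x^2/2 := by positivity
  refine (inv_anti₀ hp h).trans ?_
  rw [inv_le_iff_one_le_mul₀ hp]
  nlinarith [sq_nonneg (x^2)]

/-- The comparison function `n^y * exp (10 - 10/n)`. -/
noncomputable def cmpE (y : ℝ) (x : ℝ) : ℝ := x ^ y * Real.exp (10 - 10/x)

theorem cmpE_pos (y : ℝ) {x : ℝ} (hx : 0 < x) : 0 < cmpE y x := by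
  unfold cmpE; positivity

theorem cmpE_mono {y a b : ℝ} (hy : 0 ≤ y) (ha : 0 < a) (hab : a ≤ b) : cmpE y a ≤ cmpE y b := by
  unfold cmpE
  have : 0 < b := ha.trans_le hab
  gcongr

theorem rpow_sub_le {y N c : ℝ} (hy : 0 ≤ y) (hN : 22 ≤ N) (hc : 0 ≤ c) (hc2 : c ≤ 2) :
    (N - c)^y ≤ N^y * (1 - y*c/N + (y*c/N)^2/2) := by
  have hN0 : 0 < N := by linarith
  have h1 : N - c ≤ N * Real.exp (-(c/N)) := by
    have := Real.add_one_le_exp (-(c/N))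
    calc N - c = N * (-(c/N)+1) := by field_simp; ring
      _ ≤ _ := by gcongr
  calc (N-c)^y ≤ (N * Real.exp (-(c/N)))^y := by
        apply Real.rpow_le_rpow (by linarith) h1 hy
    _ = N^y * Real.exp (-(y*c/N)) := by
        rw [Real.mul_rpow hN0.le (Real.exp_pos _).le, ← Real.exp_mul]
        congr 2; ring
    _ ≤ _ := by
        gcongr
        exact exp_neg_le_quad (by positivity)

theorem cmpE_one {y N : ℝ} (hy : 0 ≤ y) (hN : 22 ≤ N) :
    cmpE y (N-1) ≤ cmpE y N * ((2*N^2-2*y*N+y^2)/(2*N^2)) := by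
  have hN0 : 0 < N := by linarith
  have h1 := rpow_sub_le hy hN zero_le_one one_le_two
  have h2 : Real.exp (10 - 10/(N-1)) ≤ Real.exp (10 - 10/N) := by
    have : 0 < N - 1 := by linarith
    gcongr
    linarith
  unfold cmpE
  calc _ ≤ (N^y * (1 - y*1/N + (y*1/N)^2/2)) * Real.exp (10 - 10/N) := by
        apply mul_le_mul h1 h2 (Real.exp_pos _).le
        exact (Real.rpow_nonneg (by linarith) _).trans h1
    _ = _ := by field_simp

theorem cmpE_two {y N : ℝ} (hy : 0 ≤ y) (hN : 22 ≤ N) :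
    cmpE y (N-2) ≤ cmpE y N * ((N^2-2*y*N+2*y^2)/(N^2+20)) := by
  have hN0 : 0 < N := by linarith
  have h1 := rpow_sub_le hy hN zero_le_two le_rfl
  have h2 : Real.exp (10 - 10/(N-2)) ≤ Real.exp (10 - 10/N) * (N^2/(N^2+20)) := by
    have hN2 : 0 < N - 2 := by linarith
    have e : 10/(N-2) = 10/N + 20/(N*(N-2)) := by field_simp; ring
    have e2 : 20/N^2 ≤ 20/(N*(N-2)) := by
      gcongr
      nlinarith
    have e3 : Real.exp (-(20/N^2)) ≤ N^2/(N^2+20) := by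
      rw [Real.exp_neg]
      have := Real.add_one_le_exp (20/N^2)
      have h := inv_anti₀ (by positivity) this
      refine h.trans (le_of_eq ?_)
      field_simp
      ring
    calc Real.exp (10 - 10/(N-2)) ≤ Real.exp (10 - 10/N + -(20/N^2)) := by
          apply Real.exp_le_exp.2; linarith
      _ = Real.exp (10 - 10/N) * Real.exp (-(20/N^2)) := Real.exp_add _ _
      _ ≤ _ := by gcongr
  unfold cmpE
  calc _ ≤ (N^y * (1 - y*2/N + (y*2/N)^2/2)) * (Real.exp (10 - 10/N) * (N^2/(N^2+20))) := by
        apply mul_le_mul h1 h2 (Real.exp_pos _).le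
        exact (Real.rpow_nonneg (by linarith) _).trans h1
    _ = _ := by field_simp

theorem base_exp (n : ℕ) (h2 : 2 ≤ n) (h : n < 22) : (35/2*n^2 : ℝ) ≤ Real.exp (10-10/n) := by
  have e1 : (2.718:ℝ) ≤ Real.exp 1 := by have := Real.exp_one_gt_d9; linarith
  have ek : ∀ k : ℕ, (k:ℝ) ≤ 10 - 10/n → (2.718:ℝ)^k ≤ Real.exp (10-10/n) := by
    intro k hk
    calc (2.718:ℝ)^k ≤ (Real.exp 1)^k := by gcongr
      _ = Real.exp k := by rw [← Real.exp_nat_mul, mul_one]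
      _ ≤ _ := Real.exp_le_exp.2 hk
  have hn0 : (2:ℝ) ≤ n := by exact_mod_cast h2
  have hn0' : (0:ℝ) < n := by linarith
  by_cases c1 : n = 2
  · subst c1
    refine le_trans ?_ (ek 5 (by norm_num))
    norm_num
  by_cases c2 : n < 5
  · refine le_trans ?_ (ek 6 ?_)
    · have : (n:ℝ) ≤ 4 := by exact_mod_cast (by omega : n ≤ 4)
      norm_num
      nlinarith
    · have : (3:ℝ) ≤ n := by exact_mod_cast (by omega : 3 ≤ n)
      have : 10/(n:ℝ) ≤ 10/3 := by gcongr
      push_cast; linarith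
  by_cases c3 : n < 10
  · refine le_trans ?_ (ek 8 ?_)
    · have : (n:ℝ) ≤ 9 := by exact_mod_cast (by omega : n ≤ 9)
      norm_num
      nlinarith
    · have : (5:ℝ) ≤ n := by exact_mod_cast (by omega : 5 ≤ n)
      have : 10/(n:ℝ) ≤ 10/5 := by gcongr
      push_cast; linarith
  · refine le_trans ?_ (ek 9 ?_)
    · have : (n:ℝ) ≤ 21 := by exact_mod_cast (by omega : n ≤ 21)
      norm_num
      nlinarith
    · have : (10:ℝ) ≤ n := by exact_mod_cast (by omega : 10 ≤ n)
      have : 10/(n:ℝ) ≤ 10/10 := by gcongr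
      push_cast; linarith

theorem phase_two {y : ℝ} {t s : ℕ → ℝ} (ht : GJRec y t) (hs : GJRec 2 s)
    (h0 : 0 ≤ y) (h2 : y ≤ 2) : ∀ n : ℕ, 2 ≤ n → t n ≤ n.factorial * cmpE y n := by
  obtain ⟨v0, v1, v2, -, h3, -⟩ := table hs
  have hp := phase_one hs
  have hts := gj_nonneg_le ht hs h0 h2
  have hnn : ∀ n, 0 ≤ t n := fun n => (hts n).1
  intro n
  induction n using Nat.strong_induction_on with
  | _ n ih =>
    intro hn2
    by_cases hn : n < 22
    · refine ((hts n).2.trans (h3 n hn2 hn)).trans ?_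
      gcongr
      refine (base_exp n hn2 hn).trans ?_
      unfold cmpE
      have : (1:ℝ) ≤ (n:ℝ)^y := Real.one_le_rpow (by exact_mod_cast (by omega : 1 ≤ n)) h0
      exact le_mul_of_one_le_left (Real.exp_pos _).le this
    obtain ⟨m, rfl⟩ : ∃ m, n = m + 6 + 2 := ⟨n - 8, by omega⟩
    have hm : 14 ≤ m := by omega
    have hm' : (14:ℝ) ≤ m := by exact_mod_cast hm
    have hN : (22:ℝ) ≤ (m:ℝ)+8 := by linarith
    obtain ⟨p, hpdef⟩ : ∃ p, p = cmpE y ((m:ℝ)+6) := ⟨_, rfl⟩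
    have hp0 : 0 < p := by rw [hpdef]; exact cmpE_pos y (by linarith)
    have tb : ∀ k, 2 ≤ k → k ≤ m + 6 → t k ≤ k.factorial * p := by
      intro k hk hk2
      refine (ih k (by omega) hk).trans ?_
      gcongr
      rw [hpdef]
      apply cmpE_mono h0 (by exact_mod_cast (by omega : 0 < k))
      exact_mod_cast hk2
    have bulk1 : ∀ k l, k + l = m → k ≤ l → t (k+3) * t (l+3) ≤ 25 * 120 * (m+3).factorial * p := by
      intro k l hkl hle
      obtain ⟨l, rfl⟩ : ∃ l', l = l' + 2 := ⟨l - 2, by omega⟩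
      have a := (hts (k+3)).2.trans (hp (k+3)).2
      have b := tb (l+2+3) (by omega) (by omega)
      have c : ((k+5).factorial * (l+5).factorial : ℝ) ≤ 120 * (k+l+5).factorial := by
        exact_mod_cast fact_conv 5 k l
      rw [show m + 3 = k+l+5 by omega]
      calc t (k+3) * t (l+2+3) ≤ (25 * (k+3+2).factorial) * ((l+2+3).factorial * p) :=
            mul_le_mul a b (hnn _) (by positivity)
        _ = 25 * ((k+5).factorial * (l+5).factorial : ℝ) * p := by ring
        _ ≤ 25 * (120 * (k+l+5).factorial) * p := by gcongr
        _ = _ := by ring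
    have bulk : ∑ k ∈ range (m+1), t (k+3) * t (m+6-(k+3)) ≤ (m+1) * (25 * 120 * (m+3).factorial * p) := by
      have : ∀ k ∈ range (m+1), t (k+3) * t (m+6-(k+3)) ≤ 25 * 120 * (m+3).factorial * p := by
        intro k hk
        have hk := mem_range.1 hk
        obtain ⟨l, hl⟩ : ∃ l, k + l = m := ⟨m - k, by omega⟩
        rw [show m + 6 - (k+3) = l + 3 by omega]
        rcases le_total k l with h | h
        · exact bulk1 k l hl h
        · rw [mul_comm]; exact bulk1 l k (by omega) h
      calc _ ≤ ∑ k ∈ range (m+1), (25 * 120 * (m+3).factorial * p : ℝ) := sum_le_sum this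
        _ = _ := by simp
    have hF : (0:ℝ) < (m+4).factorial := by positivity
    have bulk' : ∑ k ∈ range (m+1), t (k+3) * t (m+6-(k+3)) ≤ 3000 * (m+4).factorial * p := by
      refine bulk.trans ?_
      rw [Nat.factorial_succ (m+3)]
      push_cast
      have : (0:ℝ) ≤ (m+3).factorial * p := by positivity
      nlinarith
    have a4 := tb (m+4) (by omega) (by omega)
    have a5 := tb (m+5) (by omega) (by omega)
    have a6 := tb (m+6) (by omega) (by omega)
    have a7 := ih (m+6+1) (by omega) (by omega)
    have t0 : t 0 ≤ 8 := by rw [← v0]; exact (hts 0).2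
    have t1 : t 1 ≤ 85/3 := by rw [← v1]; exact (hts 1).2
    have t2 : t 2 ≤ 416/3 := by rw [← v2]; exact (hts 2).2
    have b6 : t 0 * t (m+6) ≤ 8 * ((m+6).factorial * p) := mul_le_mul t0 a6 (hnn _) (by norm_num)
    have b5 : t 1 * t (m+5) ≤ 85/3 * ((m+5).factorial * p) := mul_le_mul t1 a5 (hnn _) (by norm_num)
    have b4 : t 2 * t (m+4) ≤ 416/3 * ((m+4).factorial * p) := mul_le_mul t2 a4 (hnn _) (by norm_num)
    have S : ∑ k ∈ range (m+6+1), t k * t (m+6-k) ≤ 28 * ((m+6).factorial * p) := by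
      rw [sum_split]
      rw [show m+6-0 = m+6 by omega, show m+6-1 = m+5 by omega, show m+6-2=m+4 by omega,
        show m+6-(m+6) = 0 by omega, show m+6-(m+5) = 1 by omega, show m+6-(m+4) = 2 by omega,
        mul_comm (t (m+4)), mul_comm (t (m+5)), mul_comm (t (m+6))]
      generalize ∑ k ∈ range (m+1), t (k+3) * t (m+6-(k+3)) = B at bulk' ⊢
      rw [Nat.factorial_succ (m+5)] at b6 ⊢
      rw [Nat.factorial_succ (m+4)] at b5 b6 ⊢
      push_cast at b5 b6 ⊢
      have hFp : (0:ℝ) ≤ (m+4).factorial * p := by positivity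
      have : (0:ℝ) ≤ (12*(m+6)*(m+5) - 170/3*(m+5) - 832/3 - 3000) * ((m+4).factorial * p) := by
        apply mul_nonneg _ hFp
        nlinarith
      nlinarith
    rw [ht.2.2]
    have q1 := cmpE_one h0 hN
    have q2 := cmpE_two h0 hN
    rw [show (m:ℝ)+8-1 = m+7 by ring] at q1
    rw [show (m:ℝ)+8-2 = m+6 by ring, ← hpdef] at q2
    have st := step_ineq hN h0 h2
    have hA := cmpE_pos y (show (0:ℝ) < (m:ℝ)+8 by linarith)
    push_cast at a7 ⊢
    rw [show (m:ℝ)+6+1 = m+7 by ring] at a7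
    rw [show (m:ℝ)+6+2 = m+8 by ring]
    set A := cmpE y ((m:ℝ)+8)
    set X := ((((m:ℝ)+8)^2-2*y*((m:ℝ)+8)+2*y^2)/(((m:ℝ)+8)^2+20))
    set Y := ((2*((m:ℝ)+8)^2-2*y*((m:ℝ)+8)+y^2)/(2*((m:ℝ)+8)^2))
    have a7' : t (m+6+1) ≤ (m+6+1).factorial * (A * Y) := a7.trans (by gcongr)
    have a6' : t (m+6) ≤ (m+6).factorial * (A * X) := a6.trans (by gcongr)
    have S' : ∑ k ∈ range (m+6+1), t k * t (m+6-k) ≤ 28 * ((m+6).factorial * (A * X)) := S.trans (by gcongr)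
    have hm0 : (0:ℝ) ≤ m := by linarith
    calc _ ≤ 4*(3*((m:ℝ)+6)+8)/((m:ℝ)+6+3)*
        (((m:ℝ)+8)*(3*((m:ℝ)+6)+4)/36*((m+6).factorial * (A * X)) + y/6*((m+6+1).factorial * (A * Y))
          + 1/36*(28 * ((m+6).factorial * (A * X)))) := by gcongr
      _ = ((m+6).factorial * A) * (4*(3*((m:ℝ)+8)+2)/(((m:ℝ)+8)+1) * (((((m:ℝ)+8)*(3*((m:ℝ)+8)-2)+28)/36 * X
      + y/6*(((m:ℝ)+8)-1)*Y))) := by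
        rw [Nat.factorial_succ (m+6)]
        push_cast
        rw [show (m:ℝ)+6+3 = m+8+1 by ring]
        ring
      _ ≤ ((m+6).factorial * A) * (((m:ℝ)+8)*(((m:ℝ)+8)-1)) := by gcongr
      _ = _ := by
        rw [Nat.factorial_succ (m+6+1), Nat.factorial_succ (m+6)]
        push_cast
        ring

theorem H_vanish (H : ℤ → ℤ → ℚ)
    (hH1 : ∀ g : ℤ, H (-1) g = if g = 0 then 1/2 else 0)
    (hH2 : ∀ g : ℤ, H 0 g = if g = 0 then 2 else 0)
    (hHrec : ∀ n g : ℤ, 1 ≤ n → 0 ≤ g →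
      H n g = (4*n*(3*n+2)*(3*n-2)/(n+1)) * H (n-2) (g-1)
        + (4*(3*n+2)/(n+1)) *
          ∑ k ∈ Finset.Icc (-1 : ℤ) (n-1), ∑ i ∈ Finset.Icc (0 : ℤ) g,
            H k i * H (n-2-k) (g-i)) :
    ∀ N : ℕ, ∀ n g : ℤ, n = (N:ℤ) - 1 → n + 2 ≤ 2 * g → H n g = 0 := by
  intro N
  induction N using Nat.strong_induction_on with
  | _ N ih =>
    intro n g hn hg
    by_cases c1 : n = -1
    · subst c1
      rw [hH1, if_neg (by omega)]
    by_cases c2 : n = 0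
    · subst c2
      rw [hH2, if_neg (by omega)]
    have ih' : ∀ m g : ℤ, -1 ≤ m → m < n → m + 2 ≤ 2 * g → H m g = 0 := by
      intro m g h1 h2 h3
      exact ih (m+1).toNat (by omega) m g (by omega) h3
    rw [hHrec n g (by omega) (by omega), ih' (n-2) (g-1) (by omega) (by omega) (by omega),
      Finset.sum_eq_zero]
    · simp
    · intro k hk
      apply Finset.sum_eq_zero
      intro i hi
      rw [Finset.mem_Icc] at hk hi
      by_cases c : k + 2 ≤ 2 * i
      · rw [ih' k i (by omega) (by omega) c, zero_mul]
      · rw [ih' (n-2-k) (g-i) (by omega) (by omega) (by omega), mul_zero]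

open Polynomial in
/-- generating polynomial in the genus -/
noncomputable def gpoly (H : ℤ → ℤ → ℚ) (n : ℤ) : ℝ[X] :=
  ∑ g ∈ range (n.toNat + 1), C ((H n g : ℚ) : ℝ) * X ^ g

theorem gpoly_coeff (H : ℤ → ℤ → ℚ) (hv : ∀ n g : ℤ, -1 ≤ n → n + 2 ≤ 2 * g → H n g = 0) (n : ℤ) (hn : -1 ≤ n) (g : ℕ) :
    (gpoly H n).coeff g = ((H n g : ℚ) : ℝ) := by
  unfold gpoly
  rw [Polynomial.finsetSum_coeff]
  simp only [Polynomial.coeff_C_mul, Polynomial.coeff_X_pow]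
  by_cases c : g < n.toNat + 1
  · rw [Finset.sum_eq_single g]
    · simp
    · intro b _ hb
      rw [if_neg (Ne.symm hb), mul_zero]
    · intro h; exact absurd (mem_range.2 c) h
  · rw [hv n g hn (by omega), Finset.sum_eq_zero]
    · simp
    · intro b hb
      have := mem_range.1 hb
      rw [if_neg (by omega), mul_zero]

open Polynomial in
theorem gpoly_rec (H : ℤ → ℤ → ℚ) (hv : ∀ n g : ℤ, -1 ≤ n → n + 2 ≤ 2 * g → H n g = 0)
    (hH3 : ∀ n g : ℤ, g < 0 → H n g = 0)
    (hHrec : ∀ n g : ℤ, 1 ≤ n → 0 ≤ g →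
      H n g = (4*n*(3*n+2)*(3*n-2)/(n+1)) * H (n-2) (g-1)
        + (4*(3*n+2)/(n+1)) *
          ∑ k ∈ Finset.Icc (-1 : ℤ) (n-1), ∑ i ∈ Finset.Icc (0 : ℤ) g,
            H k i * H (n-2-k) (g-i))
    (n : ℤ) (hn : 1 ≤ n) :
    gpoly H n = C (4*n*(3*n+2)*(3*n-2)/(n+1) : ℝ) * (gpoly H (n-2) * X)
      + C (4*(3*n+2)/(n+1) : ℝ) * ∑ k ∈ Finset.Icc (-1 : ℤ) (n-1), gpoly H k * gpoly H (n-2-k) := by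
  have gc := gpoly_coeff H hv
  ext g
  rw [gc n (by omega), hHrec n g hn (by omega)]
  rw [coeff_add, coeff_C_mul, coeff_C_mul, finsetSum_coeff]
  push_cast
  congr 1
  · congr 1
    cases g with
    | zero => simp [hH3 (n-2) (-1) (by norm_num)]
    | succ g =>
      rw [coeff_mul_X, gc (n-2) (by omega)]
      congr 2
      push_cast; ring
  · congr 1
    apply Finset.sum_congr rfl
    intro k hk
    rw [Finset.mem_Icc] at hk
    rw [coeff_mul, Finset.Nat.sum_antidiagonal_eq_sum_range_succ_mk]
    symm
    refine Finset.sum_bij (fun i _ => (i:ℤ)) ?_ ?_ ?_ ?_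
    · intro i hi
      have := mem_range.1 hi
      rw [Finset.mem_Icc]; omega
    · intro a _ b _ h; exact_mod_cast h
    · intro b hb
      rw [Finset.mem_Icc] at hb
      exact ⟨b.toNat, mem_range.2 (by omega), by omega⟩
    · intro i hi
      have hi := mem_range.1 hi
      dsimp only
      rw [gc k (by omega), gc (n-2-k) (by omega)]
      rw [Nat.cast_sub (by omega)]

theorem gj_exists (H : ℤ → ℤ → ℚ) (hH3 : ∀ n g : ℤ, g < 0 → H n g = 0)
    (hH1 : ∀ g : ℤ, H (-1) g = if g = 0 then 1/2 else 0)
    (hH2 : ∀ g : ℤ, H 0 g = if g = 0 then 2 else 0)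
    (hHrec : ∀ n g : ℤ, 1 ≤ n → 0 ≤ g →
      H n g = (4*n*(3*n+2)*(3*n-2)/(n+1)) * H (n-2) (g-1)
        + (4*(3*n+2)/(n+1)) *
          ∑ k ∈ Finset.Icc (-1 : ℤ) (n-1), ∑ i ∈ Finset.Icc (0 : ℤ) g,
            H k i * H (n-2-k) (g-i)) (y : ℝ) (hy : 0 < y) :
    GJRec y (fun n => y^(n+2) * (gpoly H n).eval (y^2)⁻¹ / 6^n) := by
  have hv : ∀ n g : ℤ, -1 ≤ n → n + 2 ≤ 2 * g → H n g = 0 := by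
    intro n g h1 h2
    exact H_vanish H hH1 hH2 hHrec (n+1).toNat n g (by omega) h2
  have hrec := gpoly_rec H hv hH3 hHrec
  have p1 : gpoly H (-1) = Polynomial.C (1/2) := by
    unfold gpoly; simp [hH1]
  have p0 : gpoly H 0 = Polynomial.C 2 := by
    unfold gpoly; simp [hH2]
  refine ⟨?_, ?_, ?_⟩
  · simp [p0]; ring
  · have : Finset.Icc (-1:ℤ) (1-1) = {-1, 0} := by decide
    dsimp only
    rw [Nat.cast_one, hrec 1 le_rfl, this, Finset.sum_pair (by norm_num)]
    norm_num [p1, p0]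
    field_simp
    ring
  · intro n
    have e : Finset.Icc (-1:ℤ) ((n:ℤ)+2-1) = insert (-1) (insert ((n:ℤ)+1) ((range (n+1)).map Nat.castEmbedding)) := by
      ext k
      simp only [Finset.mem_Icc, Finset.mem_insert, Finset.mem_map, mem_range, Nat.castEmbedding_apply]
      constructor
      · rintro ⟨h1, h2⟩
        by_cases c : k = -1
        · exact Or.inl c
        by_cases c' : k = n+1
        · exact Or.inr (Or.inl c')
        · exact Or.inr (Or.inr ⟨k.toNat, by omega, by omega⟩)
      · rintro (h | h | ⟨a, h, rfl⟩) <;> constructor <;> omega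
    dsimp only
    rw [show ((n+2 : ℕ):ℤ) = (n:ℤ)+2 by push_cast; ring, hrec _ (by omega), e, Finset.sum_insert,
      Finset.sum_insert, Finset.sum_map]
    · have s1 : ∑ x ∈ range (n+1), gpoly H (Nat.castEmbedding x) * gpoly H ((n:ℤ)+2-2-(Nat.castEmbedding x : ℤ))
        = ∑ x ∈ range (n+1), gpoly H (x:ℤ) * gpoly H ((n - x : ℕ):ℤ) := by
        apply Finset.sum_congr rfl
        intro x hx
        have := mem_range.1 hx
        simp only [Nat.castEmbedding_apply]
        congr 2
        omega
      have s2 : ∀ z : ℝ, ∑ x ∈ range (n+1), (y^(x+2) * (gpoly H x).eval z / 6^x) * 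
          (y^(n-x+2) * (gpoly H ((n-x : ℕ):ℤ)).eval z / 6^(n-x)) = y^(n+4)/6^n * ∑ x ∈ range (n+1), 
            (gpoly H x).eval z * (gpoly H ((n-x : ℕ):ℤ)).eval z := by
        intro z
        rw [Finset.mul_sum]
        apply Finset.sum_congr rfl
        intro x hx
        have := mem_range.1 hx
        obtain ⟨l, rfl⟩ : ∃ l, n = x + l := ⟨n - x, by omega⟩
        rw [show x + l - x = l by omega]
        field_simp
        ring
      rw [s1, s2]
      rw [show (n:ℤ)+2-2-(-1) = n+1 by ring, show (n:ℤ)+2-2-(n+1) = -1 by ring, show (n:ℤ)+2-2 = n by ring, p1]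
      simp only [Polynomial.eval_add, Polynomial.eval_mul, Polynomial.eval_C, Polynomial.eval_X,
        Polynomial.eval_finsetSum]
      push_cast
      have h3 : (n:ℝ)+3 ≠ 0 := by positivity
      have h3' : (n:ℝ)+2+1 ≠ 0 := by positivity
      generalize ∑ x ∈ range (n+1), (gpoly H x).eval (y^2)⁻¹ * (gpoly H ((n-x : ℕ):ℤ)).eval (y^2)⁻¹ = B
      rw [show (n:ℝ)+2+1 = n+3 by ring]
      field_simp
      ring
    · simp
      intro x hx
      omega
    · simp only [Finset.mem_insert, Finset.mem_map, mem_range, Nat.castEmbedding_apply, not_or, not_exists]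
      refine ⟨by omega, ?_⟩
      rintro x ⟨_, h⟩
      omega


theorem h_le_exp_ten
    (H : ℤ → ℤ → ℚ)
    (hH1 : ∀ g : ℤ, H (-1) g = if g = 0 then 1/2 else 0)
    (hH2 : ∀ g : ℤ, H 0 g = if g = 0 then 2 else 0)
    (hH3 : ∀ n g : ℤ, g < 0 → H n g = 0)
    (hHrec : ∀ n g : ℤ, 1 ≤ n → 0 ≤ g →
      H n g = (4*n*(3*n+2)*(3*n-2)/(n+1)) * H (n-2) (g-1)
        + (4*(3*n+2)/(n+1)) *
          ∑ k ∈ Finset.Icc (-1 : ℤ) (n-1), ∑ i ∈ Finset.Icc (0 : ℤ) g,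
            H k i * H (n-2-k) (g-i)) :
    ∀ n : ℕ, 2 ≤ n → ∀ y : ℝ, 0 ≤ y → y ≤ 2 →
      (n : ℝ) ^ (-y) *
          ((Nat.factorial n : ℝ)⁻¹ * (6 : ℝ) ^ (-(n : ℤ)) *
            ∑ g ∈ Finset.Icc (0 : ℤ) (n : ℤ),
              ((H (n : ℤ) g : ℚ) : ℝ) * y ^ ((n : ℤ) + 2 - 2 * g))
        ≤ Real.exp (10 - 10 / n) := by
  intro n hn y h0 h2
  rcases h0.eq_or_lt with h | hy
  · subst h
    rw [Finset.sum_eq_zero]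
    · rw [mul_zero, mul_zero]; exact (Real.exp_pos _).le
    · intro g hg
      by_cases c : (n:ℤ) + 2 ≤ 2 * g
      · rw [H_vanish H hH1 hH2 hHrec (n+1) n g (by push_cast; ring) c]; simp
      · rw [zero_zpow _ (by omega), mul_zero]
  · have ht := gj_exists H hH3 hH1 hH2 hHrec y hy
    have hs := gj_exists H hH3 hH1 hH2 hHrec 2 two_pos
    have key := phase_two ht hs h0 h2 n hn
    have e : ∑ g ∈ Finset.Icc (0 : ℤ) (n : ℤ), ((H (n : ℤ) g : ℚ) : ℝ) * y ^ ((n : ℤ) + 2 - 2 * g)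
        = y^(n+2) * (gpoly H n).eval (y^2)⁻¹ := by
      unfold gpoly
      rw [Polynomial.eval_finsetSum, Finset.mul_sum]
      symm
      refine Finset.sum_bij (fun i _ => (i:ℤ)) ?_ ?_ ?_ ?_
      · intro i hi
        have := mem_range.1 hi
        rw [Finset.mem_Icc]; omega
      · intro a _ b _ h; exact_mod_cast h
      · intro b hb
        rw [Finset.mem_Icc] at hb
        exact ⟨b.toNat, mem_range.2 (by omega), by omega⟩
      · intro i hi
        rw [zpow_sub₀ hy.ne', zpow_mul]
        simp only [Polynomial.eval_mul, Polynomial.eval_C, Polynomial.eval_pow, Polynomial.eval_X]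
        rw [show ((n:ℤ)+2) = ((n+2 : ℕ) : ℤ) by push_cast; ring, zpow_natCast, zpow_natCast, inv_pow]
        have : y ^ (2:ℤ) = y^2 := by norm_cast
        rw [this]
        ring
    rw [e]
    have hn0 : (0:ℝ) < n := by exact_mod_cast (by omega : 0 < n)
    unfold cmpE at key
    have hf : (0:ℝ) < n.factorial := by positivity
    have hny : (0:ℝ) < (n:ℝ)^y := by positivity
    rw [Real.rpow_neg hn0.le, zpow_neg, zpow_natCast]
    calc _ = ((n:ℝ)^y)⁻¹ * ((n.factorial : ℝ)⁻¹ * (y^(n+2) * (gpoly H n).eval (y^2)⁻¹ / 6^n)) := by ring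
      _ ≤ ((n:ℝ)^y)⁻¹ * ((n.factorial : ℝ)⁻¹ * (n.factorial * ((n:ℝ)^y * Real.exp (10 - 10/n)))) := by gcongr
      _ = _ := by field_simp
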